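/- A bounded-degree element f of the noncommutative superspace algebra ℚ^θ⟨⟨x⟩⟩ is a quasisymmetric function in noncommuting variables in superspace (i.e. f(u) = f(v) whenever std(u) = std(v)) if and only if σ · f = f for every σ in the finitary symmetric group S_∞ acting by the quasisymmetrizing action in noncommuting variables. -/

import Mathlib

/-- A noncommutative superspace monomial: `S` records the θ-indices (taken in increasing
order) and `w` is the word of `x`-indices. -/
structure NCMon where
  S : Finset ℕ
  w : List ℕ
deriving DecidableEq

namespace NCMon

/-- The set of indices of a noncommutative superspace monomial. -/
def ind (u : NCMon) : Finset ℕ := u.S ∪ u.w.toFinset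

/-- The total degree of a noncommutative superspace monomial. -/
def deg (u : NCMon) : ℕ := u.S.card + u.w.length

end NCMon

/-- The rank of `a` in the finite set `A`: the number of elements of `A` that are `≤ a`. -/
def rk (A : Finset ℕ) (a : ℕ) : ℕ := (A.filter (· ≤ a)).card

/-- Standardization of a monomial: relabel its indices via the unique order-preserving
bijection `ind u → {1, …, k}`. -/
def NCMon.std (u : NCMon) : NCMon := ⟨u.S.image (rk u.ind), u.w.map (rk u.ind)⟩

/-- The set supercomposition `I(u)` associated with a monomial `u`: its `r`-th block
records the (1-indexed) positions of the `r`-th smallest index in the word, together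
with `0` whenever that index is a θ-index. -/
def NCMon.scomp (u : NCMon) : List (Finset ℕ) :=
  (List.range u.ind.card).map fun r₀ =>
    (((Finset.range u.w.length).filter fun t => rk u.ind (u.w.getD t 0) = r₀ + 1).image (· + 1))
      ∪ (if r₀ + 1 ∈ u.S.image (rk u.ind) then ({0} : Finset ℕ) else ∅)

/-- The monomial quasisymmetric function in noncommuting variables in superspace:
the indicator function of the monomials whose set supercomposition is `I`. -/
def Mfn (I : List (Finset ℕ)) : NCMon → ℚ := fun u => if u.scomp = I then 1 else 0

/-- Number of inversions between two θ-supports. -/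
def invST (S T : Finset ℕ) : ℕ := ((S ×ˢ T).filter fun p => p.2 < p.1).card

/-- The product of coefficient functions, induced by the signed monomial product
`(S,w)·(T,v) = 0` if `S ∩ T ≠ ∅` and `(-1)^{inv(S,T)} (S ∪ T, w·v)` otherwise. -/
def mulF (f g : NCMon → ℚ) : NCMon → ℚ := fun m =>
  ∑ k ∈ Finset.range (m.w.length + 1), ∑ S₁ ∈ m.S.powerset,
    (-1 : ℚ) ^ invST S₁ (m.S \ S₁) * f ⟨S₁, m.w.take k⟩ * g ⟨m.S \ S₁, m.w.drop k⟩

/-- Quasisymmetry in noncommuting variables in superspace: the coefficient of a monomial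
depends only on its standardization. -/
def QSymNC (f : NCMon → ℚ) : Prop := ∀ u v : NCMon, u.std = v.std → f u = f v

/-- Bounded degree. -/
def BddDeg (f : NCMon → ℚ) : Prop := ∃ N, ∀ u : NCMon, f u ≠ 0 → u.deg ≤ N

/-- The quasisymmetrizing action in noncommuting variables in superspace of the simple
transposition `s_i` on monomials: in the associated pseudo set supercomposition (padded
with trailing empty blocks), the blocks in positions `i` and `i+1` are interchanged when
at least one of them is empty. -/
def sNC (i : ℕ) (u : NCMon) : NCMon :=
  if i ∉ u.ind ∨ i + 1 ∉ u.ind then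
    ⟨u.S.image fun a => Equiv.swap i (i + 1) a, u.w.map fun a => Equiv.swap i (i + 1) a⟩
  else u

/-- Relabelling of the indices of a monomial. -/
def NCMon.map (φ : ℕ → ℕ) (u : NCMon) : NCMon := ⟨u.S.image φ, u.w.map φ⟩

theorem NCMon.eq_iff {u v : NCMon} : u = v ↔ u.S = v.S ∧ u.w = v.w := by
  cases u; cases v; simp

theorem NCMon.ind_map (φ : ℕ → ℕ) (u : NCMon) : (u.map φ).ind = u.ind.image φ := by
  ext a
  simp only [NCMon.ind, NCMon.map, Finset.mem_union, Finset.mem_image, List.mem_toFinset,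
    List.mem_map]
  grind

theorem NCMon.mem_ind_of_mem_S {u : NCMon} {a : ℕ} (h : a ∈ u.S) : a ∈ u.ind :=
  Finset.mem_union_left _ h

theorem NCMon.mem_ind_of_mem_w {u : NCMon} {a : ℕ} (h : a ∈ u.w) : a ∈ u.ind :=
  Finset.mem_union_right _ (List.mem_toFinset.2 h)

theorem NCMon.map_congr {φ ψ : ℕ → ℕ} {u : NCMon} (h : ∀ a ∈ u.ind, φ a = ψ a) :
    u.map φ = u.map ψ :=
  NCMon.eq_iff.2
    ⟨Finset.image_congr fun a ha => h a (NCMon.mem_ind_of_mem_S ha),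
      List.map_congr_left fun a ha => h a (NCMon.mem_ind_of_mem_w ha)⟩

theorem NCMon.map_map (φ ψ : ℕ → ℕ) (u : NCMon) : (u.map φ).map ψ = u.map (ψ ∘ φ) := by
  simp [NCMon.map, Finset.image_image]

theorem NCMon.map_injective {φ : ℕ → ℕ} (hφ : Function.Injective φ) :
    Function.Injective (NCMon.map φ) := fun u v h => by
  obtain ⟨hS, hw⟩ := NCMon.eq_iff.1 h
  exact NCMon.eq_iff.2
    ⟨Finset.image_injective hφ hS, List.map_injective_iff.2 hφ hw⟩

theorem rk_image {φ : ℕ → ℕ} {A : Finset ℕ} (hφ : StrictMonoOn φ A) {a : ℕ} (ha : a ∈ A) :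
    rk (A.image φ) (φ a) = rk A a := by
  have h : (A.image φ).filter (· ≤ φ a) = (A.filter (· ≤ a)).image φ := by
    rw [Finset.filter_image]
    congr 1
    exact Finset.filter_congr fun b hb => hφ.le_iff_le hb ha
  rw [rk, rk, h]
  exact Finset.card_image_of_injOn
    (hφ.injOn.mono (Finset.coe_subset.2 (Finset.filter_subset _ _)))

theorem NCMon.std_map {φ : ℕ → ℕ} {u : NCMon} (hφ : StrictMonoOn φ u.ind) :
    (u.map φ).std = u.std := by
  change (u.map φ).map (rk (u.map φ).ind) = u.map (rk u.ind)
  rw [NCMon.map_map, NCMon.ind_map]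
  exact NCMon.map_congr fun a ha => rk_image hφ ha

theorem sNC_of_notMem {i : ℕ} {u : NCMon} (h : i ∉ u.ind ∨ i + 1 ∉ u.ind) :
    sNC i u = u.map (Equiv.swap i (i + 1)) := if_pos h

theorem strictMonoOn_swap {i : ℕ} {A : Finset ℕ} (h : i ∉ A ∨ i + 1 ∉ A) :
    StrictMonoOn (Equiv.swap i (i + 1)) (A : Set ℕ) := by
  intro a ha b hb hab
  rw [Finset.mem_coe] at ha hb
  simp only [Equiv.swap_apply_def]
  grind

theorem std_sNC (i : ℕ) (u : NCMon) : (sNC i u).std = u.std := by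
  by_cases h : i ∉ u.ind ∨ i + 1 ∉ u.ind
  · rw [sNC_of_notMem h, NCMon.std_map (strictMonoOn_swap h)]
  · rw [sNC, if_neg h]

theorem std_foldr_sNC (l : List ℕ) (u : NCMon) : (l.foldr sNC u).std = u.std := by
  induction l with
  | nil => rfl
  | cons i l ih => rw [List.foldr_cons, std_sNC, ih]

theorem sum_ind_sNC_lt {i : ℕ} {u : NCMon} (h : i + 1 ∈ u.ind) (hi : i ∉ u.ind) :
    ∑ a ∈ (sNC i u).ind, a < ∑ a ∈ u.ind, a := by
  rw [sNC_of_notMem (Or.inl hi), NCMon.ind_map,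
    Finset.sum_image (Equiv.injective _).injOn]
  refine Finset.sum_lt_sum (fun a ha => ?_) ⟨i + 1, h, by simp⟩
  have hne : a ≠ i := fun e => hi (e ▸ ha)
  rw [Equiv.swap_apply_def]
  grind

/-- Every monomial can be moved by the quasisymmetrizing action to one whose pseudo set
supercomposition has no empty blocks. -/
theorem exists_foldr_sNC_packed (u : NCMon) :
    ∃ l : List ℕ, ∀ i, i + 1 ∈ (l.foldr sNC u).ind → i ∈ (l.foldr sNC u).ind := by
  induction hn : ∑ a ∈ u.ind, a using Nat.strong_induction_on generalizing u with
  | _ n ih =>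
    by_cases h : ∀ i, i + 1 ∈ u.ind → i ∈ u.ind
    · exact ⟨[], h⟩
    · push Not at h
      obtain ⟨i, h, hi⟩ := h
      obtain ⟨l, hl⟩ := ih _ (hn ▸ sum_ind_sNC_lt h hi) (sNC i u) rfl
      exact ⟨l ++ [i], by simpa using hl⟩

theorem rk_eq_succ_of_packed {A : Finset ℕ} (h : ∀ i, i + 1 ∈ A → i ∈ A) {a : ℕ}
    (ha : a ∈ A) : rk A a = a + 1 := by
  have hA : IsLowerSet (A : Set ℕ) := fun b c hcb hb =>
    Nat.decreasingInduction (motive := fun m _ => m ∈ A) (fun k _ hk => h k hk) hb hcb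
  have hr : A.filter (· ≤ a) = Finset.range (a + 1) := by
    ext b
    simp only [Finset.mem_filter, Finset.mem_range, Nat.lt_succ_iff]
    exact ⟨fun hb => hb.2, fun hb => ⟨hA hb ha, hb⟩⟩
  rw [rk, hr, Finset.card_range]

theorem NCMon.std_of_packed {u : NCMon} (h : ∀ i, i + 1 ∈ u.ind → i ∈ u.ind) :
    u.std = u.map Nat.succ :=
  NCMon.map_congr fun _ ha => rk_eq_succ_of_packed h ha

/-- **Proposition.** A bounded-degree element `f` of the noncommutative superspace
algebra `ℚ^θ⟨⟨x⟩⟩` is a quasisymmetric function in noncommuting variables in superspace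
(`f u = f v` whenever `std u = std v`) if and only if `σ · f = f` for every `σ` in the
finitary symmetric group `S_∞` (given as a word in the adjacent transpositions) acting by
the quasisymmetrizing action in noncommuting variables. -/
theorem qsymNC_iff_invariant (f : NCMon → ℚ) (hf : BddDeg f) :
    QSymNC f ↔ ∀ (l : List ℕ) (u : NCMon), f (l.foldr sNC u) = f u := by
  refine ⟨fun h l u => h _ _ (std_foldr_sNC l u), fun h u v huv => ?_⟩
  obtain ⟨l, hl⟩ := exists_foldr_sNC_packed u
  obtain ⟨m, hm⟩ := exists_foldr_sNC_packed v
  rw [← std_foldr_sNC l u, ← std_foldr_sNC m v, NCMon.std_of_packed hl,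
    NCMon.std_of_packed hm] at huv
  rw [← h l u, ← h m v, NCMon.map_injective Nat.succ_injective huv]
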